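/- arXiv:1810.12133 — 2 statements merged into one kernel-verified Lean document; each statement's English description precedes it below -/
import Mathlib

section
/- Let u, v : ℝ² → ℂ be twice continuously differentiable functions of (x,t). Then (u,v) satisfies the MT system if and only if for every k ∈ ℂ∖{0} and every (x,t) ∈ ℝ² the zero-curvature identity ∂_t U(x,t,k) − ∂_x V(x,t,k) + (i/4)(k⁻¹−k)[σ₃, V(x,t,k)] − (i/4)(k⁻¹+k)[σ₃, U(x,t,k)] + [U(x,t,k), V(x,t,k)] = 0 holds. (This identity is exactly the compatibility condition of the k-Lax pair.) -/
open Complex Matrix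

noncomputable section

abbrev M2 : Type := Matrix (Fin 2) (Fin 2) ℂ

/-- partial derivative in `x` (first coordinate). -/
def pdx (f : ℝ × ℝ → ℂ) (p : ℝ × ℝ) : ℂ := fderiv ℝ f p (1, 0)

/-- partial derivative in `t` (second coordinate). -/
def pdt (f : ℝ × ℝ → ℂ) (p : ℝ × ℝ) : ℂ := fderiv ℝ f p (0, 1)

/-- entrywise partial derivative in `x` of a matrix-valued function. -/
def Mdx (M : ℝ × ℝ → M2) (p : ℝ × ℝ) : M2 := Matrix.of fun i j => pdx (fun q => M q i j) p

/-- entrywise partial derivative in `t` of a matrix-valued function. -/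
def Mdt (M : ℝ × ℝ → M2) (p : ℝ × ℝ) : M2 := Matrix.of fun i j => pdt (fun q => M q i j) p

def sigma3 : M2 := !![1, 0; 0, -1]

/-- matrix commutator. -/
def mcomm (A B : M2) : M2 := A * B - B * A

/-- `|w|²` as a complex number. -/
def nsq (w : ℂ) : ℂ := (Complex.normSq w : ℂ)

/-- complex conjugation. -/
def cj (w : ℂ) : ℂ := (starRingEnd ℂ) w

/-- the massive Thirring system. -/
def MTsys (u v : ℝ × ℝ → ℂ) : Prop :=
  ∀ p : ℝ × ℝ,
    Complex.I * (pdt u p + pdx u p) + v p + nsq (v p) * u p = 0 ∧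
    Complex.I * (pdt v p - pdx v p) + u p + nsq (u p) * v p = 0

def U1m (u v : ℝ × ℝ → ℂ) (p : ℝ × ℝ) : M2 :=
  !![-(Complex.I/4) * (nsq (u p) + nsq (v p)), (Complex.I/2) * cj (u p);
     pdx u p - (Complex.I/2) * u p * nsq (v p) - (Complex.I/2) * v p,
     (Complex.I/4) * (nsq (u p) + nsq (v p))]

def U2m (u v : ℝ × ℝ → ℂ) (p : ℝ × ℝ) : M2 :=
  !![u p * cj (v p), -cj (v p);
     u p + (u p)^2 * cj (v p), -(u p * cj (v p))]

def V1m (u v : ℝ × ℝ → ℂ) (p : ℝ × ℝ) : M2 :=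
  !![(Complex.I/4) * (nsq (u p) - nsq (v p)), -(Complex.I/2) * cj (u p);
     pdt u p - (Complex.I/2) * u p * nsq (v p) - (Complex.I/2) * v p,
     -((Complex.I/4) * (nsq (u p) - nsq (v p)))]

/-- the matrix `U(x,t,k)` of the k-Lax pair. -/
def Umat (u v : ℝ × ℝ → ℂ) (k : ℂ) (p : ℝ × ℝ) : M2 :=
  U1m u v p + (Complex.I/(2*k)) • U2m u v p

/-- the matrix `V(x,t,k)` of the k-Lax pair. -/
def Vmat (u v : ℝ × ℝ → ℂ) (k : ℂ) (p : ℝ × ℝ) : M2 :=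
  V1m u v p + (Complex.I/(2*k)) • U2m u v p


def HD (w p : ℝ × ℝ) (f : ℝ × ℝ → ℂ) (d : ℂ) : Prop :=
  DifferentiableAt ℝ f p ∧ fderiv ℝ f p w = d

theorem HD.add {w p : ℝ × ℝ} {f g : ℝ × ℝ → ℂ} {a b : ℂ} (hf : HD w p f a) (hg : HD w p g b) :
    HD w p (fun q => f q + g q) (a + b) := by
  refine ⟨hf.1.add hg.1, ?_⟩
  rw [fderiv_fun_add hf.1 hg.1, ← hf.2, ← hg.2]; rfl

theorem HD.sub {w p : ℝ × ℝ} {f g : ℝ × ℝ → ℂ} {a b : ℂ} (hf : HD w p f a) (hg : HD w p g b) :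
    HD w p (fun q => f q - g q) (a - b) := by
  refine ⟨hf.1.sub hg.1, ?_⟩
  rw [fderiv_fun_sub hf.1 hg.1, ← hf.2, ← hg.2]; rfl

theorem HD.neg {w p : ℝ × ℝ} {f : ℝ × ℝ → ℂ} {a : ℂ} (hf : HD w p f a) :
    HD w p (fun q => - f q) (-a) := by
  refine ⟨hf.1.neg, ?_⟩
  rw [fderiv_fun_neg, ← hf.2]; rfl

theorem HD.mul {w p : ℝ × ℝ} {f g : ℝ × ℝ → ℂ} {a b : ℂ} (hf : HD w p f a) (hg : HD w p g b) :
    HD w p (fun q => f q * g q) (f p * b + g p * a) := by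
  refine ⟨hf.1.mul hg.1, ?_⟩
  rw [fderiv_fun_mul hf.1 hg.1, ← hf.2, ← hg.2]; rfl

theorem HD.cmul {w p : ℝ × ℝ} {f : ℝ × ℝ → ℂ} {a : ℂ} (c : ℂ) (hf : HD w p f a) :
    HD w p (fun q => c * f q) (c * a) := by
  refine ⟨hf.1.const_mul c, ?_⟩
  rw [fderiv_const_mul hf.1, ← hf.2]; rfl

theorem HD.cj {w p : ℝ × ℝ} {f : ℝ × ℝ → ℂ} {a : ℂ} (hf : HD w p f a) :
    HD w p (fun q => cj (f q)) (cj a) := by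
  have h := (Complex.conjCLE.toContinuousLinearMap.hasFDerivAt (x := f p)).comp p hf.1.hasFDerivAt
  refine ⟨h.differentiableAt, ?_⟩
  have h2 := h.fderiv
  have h3 : (fun q => _root_.cj (f q)) = (Complex.conjCLE.toContinuousLinearMap : ℂ → ℂ) ∘ f := by
    funext q; simp [_root_.cj]
  rw [h3, h2, ← hf.2]
  simp [_root_.cj]

theorem nsq_eq (w : ℂ) : nsq w = w * cj w := by
  simp [nsq, cj, Complex.mul_conj]

theorem cj_cj (w : ℂ) : cj (cj w) = w := by simp [cj]
theorem cj_inj {w z : ℂ} (h : cj w = cj z) : w = z := by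
  rw [← cj_cj w, h, cj_cj]

section deriv
variable {w p : ℝ × ℝ} {u v g : ℝ × ℝ → ℂ} {du dv dg : ℂ}

theorem HD.nsq (hu : HD w p u du) :
    HD w p (fun q => nsq (u q)) (u p * _root_.cj du + _root_.cj (u p) * du) := by
  simp only [nsq_eq]
  exact hu.mul hu.cj

theorem HD.e11 (hu : HD w p u du) (hv : HD w p v dv) (c d e : ℂ) :
    HD w p (fun q => d * _root_.nsq (u q) + e * _root_.nsq (v q) + c * (u q * _root_.cj (v q)))
     (d * (u p * _root_.cj du + _root_.cj (u p) * du)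
       + e * (v p * _root_.cj dv + _root_.cj (v p) * dv)
       + c * (u p * _root_.cj dv + _root_.cj (v p) * du)) :=
  ((hu.nsq.cmul d).add (hv.nsq.cmul e)).add ((hu.mul hv.cj).cmul c)

theorem HD.e12 (hu : HD w p u du) (hv : HD w p v dv) (c d : ℂ) :
    HD w p (fun q => d * _root_.cj (u q) + c * (- _root_.cj (v q)))
     (d * _root_.cj du + c * (- _root_.cj dv)) :=
  (hu.cj.cmul d).add (hv.cj.neg.cmul c)

theorem HD.e21 (hg : HD w p g dg) (hu : HD w p u du) (hv : HD w p v dv) (c : ℂ) :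
    HD w p (fun q => g q - (I / 2) * (u q * _root_.nsq (v q)) - (I / 2) * v q
        + c * (u q + u q * u q * _root_.cj (v q)))
     (dg - (I / 2) * (u p * (v p * _root_.cj dv + _root_.cj (v p) * dv) + _root_.nsq (v p) * du)
       - (I / 2) * dv
       + c * (du + (u p * u p * _root_.cj dv + _root_.cj (v p) * (u p * du + u p * du)))) :=
  ((hg.sub ((hu.mul hv.nsq).cmul _)).sub (hv.cmul _)).add
    ((hu.add ((hu.mul hu).mul hv.cj)).cmul c)

end deriv

theorem HD.of {w p : ℝ × ℝ} {f : ℝ × ℝ → ℂ} (h : ContDiff ℝ 2 f) :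
    HD w p f (fderiv ℝ f p w) := ⟨(h.differentiable (by norm_num)).differentiableAt, rfl⟩

theorem HD.of2 {w z p : ℝ × ℝ} {f : ℝ × ℝ → ℂ} (h : ContDiff ℝ 2 f) :
    HD w p (fun q => fderiv ℝ f q z) (fderiv ℝ (fderiv ℝ f) p w z) := by
  have h1 : DifferentiableAt ℝ (fderiv ℝ f) p :=
    ((h.fderiv_right (m := 1) (by norm_num)).differentiable (by norm_num)).differentiableAt
  have h2 := h1.hasFDerivAt.clm_apply (hasFDerivAt_const z p)
  refine ⟨h2.differentiableAt, ?_⟩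
  rw [h2.fderiv]; simp

theorem symm2 {f : ℝ × ℝ → ℂ} (h : ContDiff ℝ 2 f) (p w z : ℝ × ℝ) :
    fderiv ℝ (fderiv ℝ f) p w z = fderiv ℝ (fderiv ℝ f) p z w :=
  (h.contDiffAt.isSymmSndFDerivAt (by simp)) w z

theorem U_entries (u v : ℝ × ℝ → ℂ) (k : ℂ) (p : ℝ × ℝ) : Umat u v k p =
  !![-(I/4) * nsq (u p) + -(I/4) * nsq (v p) + (I/(2*k)) * (u p * cj (v p)),
     (I/2) * cj (u p) + (I/(2*k)) * (- cj (v p));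
     pdx u p - (I/2) * (u p * nsq (v p)) - (I/2) * v p
       + (I/(2*k)) * (u p + u p * u p * cj (v p)),
     (I/4) * nsq (u p) + (I/4) * nsq (v p) + (-(I/(2*k))) * (u p * cj (v p))] := by
  ext i j
  fin_cases i <;> fin_cases j <;> simp [Umat, U1m, U2m] <;> ring

theorem V_entries (u v : ℝ × ℝ → ℂ) (k : ℂ) (p : ℝ × ℝ) : Vmat u v k p =
  !![(I/4) * nsq (u p) + -(I/4) * nsq (v p) + (I/(2*k)) * (u p * cj (v p)),
     -(I/2) * cj (u p) + (I/(2*k)) * (- cj (v p));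
     pdt u p - (I/2) * (u p * nsq (v p)) - (I/2) * v p
       + (I/(2*k)) * (u p + u p * u p * cj (v p)),
     -(I/4) * nsq (u p) + (I/4) * nsq (v p) + (-(I/(2*k))) * (u p * cj (v p))] := by
  ext i j
  fin_cases i <;> fin_cases j <;> simp [Vmat, V1m, U2m] <;> ring

theorem MdtU (u v : ℝ × ℝ → ℂ) (hu : ContDiff ℝ 2 u) (hv : ContDiff ℝ 2 v) (k : ℂ) (p : ℝ × ℝ) :
  Mdt (Umat u v k) p = 
  !![-(I/4) * (u p * cj (pdt u p) + cj (u p) * pdt u p)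
       + -(I/4) * (v p * cj (pdt v p) + cj (v p) * pdt v p)
       + (I/(2*k)) * (u p * cj (pdt v p) + cj (v p) * pdt u p),
     (I/2) * cj (pdt u p) + (I/(2*k)) * (- cj (pdt v p));
     fderiv ℝ (fderiv ℝ u) p (0, 1) (1, 0)
       - (I / 2) * (u p * (v p * cj (pdt v p) + cj (v p) * pdt v p) + nsq (v p) * pdt u p)
       - (I / 2) * pdt v p
       + (I/(2*k)) * (pdt u p + (u p * u p * cj (pdt v p) + cj (v p) * (u p * pdt u p + u p * pdt u p))),
     (I/4) * (u p * cj (pdt u p) + cj (u p) * pdt u p)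
       + (I/4) * (v p * cj (pdt v p) + cj (v p) * pdt v p)
       + (-(I/(2*k))) * (u p * cj (pdt v p) + cj (v p) * pdt u p)] := by
  have h1 : HD (0, 1) p u (pdt u p) := HD.of hu
  have h2 : HD (0, 1) p v (pdt v p) := HD.of hv
  have h3 : HD (0, 1) p (fun q => pdx u q) _ := HD.of2 hu
  unfold Mdt
  simp only [U_entries]
  ext i j
  fin_cases i <;> fin_cases j
  · exact (h1.e11 h2 _ _ _).2
  · exact (h1.e12 h2 _ _).2
  · exact (h3.e21 h1 h2 _).2
  · exact (h1.e11 h2 _ _ _).2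

theorem MdxV (u v : ℝ × ℝ → ℂ) (hu : ContDiff ℝ 2 u) (hv : ContDiff ℝ 2 v) (k : ℂ) (p : ℝ × ℝ) :
  Mdx (Vmat u v k) p = 
  !![(I/4) * (u p * cj (pdx u p) + cj (u p) * pdx u p)
       + -(I/4) * (v p * cj (pdx v p) + cj (v p) * pdx v p)
       + (I/(2*k)) * (u p * cj (pdx v p) + cj (v p) * pdx u p),
     -(I/2) * cj (pdx u p) + (I/(2*k)) * (- cj (pdx v p));
     fderiv ℝ (fderiv ℝ u) p (0, 1) (1, 0)
       - (I / 2) * (u p * (v p * cj (pdx v p) + cj (v p) * pdx v p) + nsq (v p) * pdx u p)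
       - (I / 2) * pdx v p
       + (I/(2*k)) * (pdx u p + (u p * u p * cj (pdx v p) + cj (v p) * (u p * pdx u p + u p * pdx u p))),
     -(I/4) * (u p * cj (pdx u p) + cj (u p) * pdx u p)
       + (I/4) * (v p * cj (pdx v p) + cj (v p) * pdx v p)
       + (-(I/(2*k))) * (u p * cj (pdx v p) + cj (v p) * pdx u p)] := by
  have h1 : HD (1, 0) p u (pdx u p) := HD.of hu
  have h2 : HD (1, 0) p v (pdx v p) := HD.of hv
  have h3 : HD (1, 0) p (fun q => pdt u q) _ := HD.of2 hu
  rw [symm2 hu p (0, 1) (1, 0)]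
  unfold Mdx
  simp only [V_entries]
  ext i j
  fin_cases i <;> fin_cases j
  · exact (h1.e11 h2 _ _ _).2
  · exact (h1.e12 h2 _ _).2
  · exact (h3.e21 h1 h2 _).2
  · exact (h1.e11 h2 _ _ _).2

/-- the MT system is equivalent to the zero-curvature identity of
the k-Lax pair, for every nonzero spectral parameter k and every point. -/
theorem mt_iff_zero_curvature_k
    (u v : ℝ × ℝ → ℂ) (hu : ContDiff ℝ 2 u) (hv : ContDiff ℝ 2 v) :
    MTsys u v ↔
      ∀ k : ℂ, k ≠ 0 → ∀ p : ℝ × ℝ,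
        Mdt (Umat u v k) p - Mdx (Vmat u v k) p
          + (Complex.I / 4 * (k⁻¹ - k)) • mcomm sigma3 (Vmat u v k p)
          - (Complex.I / 4 * (k⁻¹ + k)) • mcomm sigma3 (Umat u v k p)
          + mcomm (Umat u v k p) (Vmat u v k p) = 0 := by
  constructor
  · intro h k hk p
    obtain ⟨h1, h2⟩ := h p
    have c1 := congrArg cj h1
    have c2 := congrArg cj h2
    rw [MdtU u v hu hv, MdxV u v hu hv, U_entries, V_entries]
    simp only [nsq_eq] at *
    simp only [cj, map_add, map_sub, map_mul, map_zero, Complex.conj_I, Complex.conj_conj] at c1 c2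
    simp only [← cj.eq_1] at c1 c2
    generalize cj (pdt u p) = Ut at *
    generalize cj (pdx u p) = Ux at *
    generalize cj (pdt v p) = Vt at *
    generalize cj (pdx v p) = Vx at *
    generalize pdt u p = ut at *
    generalize pdx u p = ux at *
    generalize pdt v p = vt at *
    generalize pdx v p = vx at *
    generalize cj (u p) = A at *
    generalize cj (v p) = B at *
    generalize u p = a at *
    generalize v p = b at *
    generalize fderiv ℝ (fderiv ℝ u) p (0, 1) (1, 0) = z at *
    have hI : I * I = -1 := I_mul_I
    have e1 : ut = -ux + I * (b + b * B * a) := by linear_combination (-I) * h1 + (ut + ux) * hI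
    have e2 : vt = vx + I * (a + a * A * b) := by linear_combination (-I) * h2 + (vt - vx) * hI
    have e3 : Ut = -Ux - I * (B + B * b * A) := by linear_combination (I) * c1 + (Ut + Ux) * hI
    have e4 : Vt = Vx - I * (A + A * a * B) := by linear_combination (I) * c2 + (Vt - Vx) * hI
    have hc : ∃ m : ℂ, k⁻¹ = m ∧ k * m = 1 := ⟨_, rfl, mul_inv_cancel₀ hk⟩
    obtain ⟨m, hm, hkm⟩ := hc
    have hkc : I / (2 * k) = I / 2 * m := by rw [← hm]; field_simp
    rw [hkc, hm]
    subst e1 e2 e3 e4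
    clear h1 h2 c1 c2 hkc hm
    have hI2 : I ^ 2 = -1 := I_sq
    have hI3 : I ^ 3 = -I := by rw [pow_succ, I_sq]; ring
    have hI4 : I ^ 4 = 1 := I_pow_four
    ext i j
    fin_cases i <;> fin_cases j <;> simp [mcomm, sigma3, Matrix.mul_fin_two] <;> grind
  · intro h p
    have H1 := congrFun (congrFun (h 1 one_ne_zero p) 0) 1
    have H2 := congrFun (congrFun (h (-1) (by norm_num) p) 0) 1
    rw [MdtU u v hu hv, MdxV u v hu hv, U_entries, V_entries] at H1 H2
    simp [mcomm, sigma3, Matrix.mul_fin_two, nsq_eq] at H1 H2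
    have hI2 : I ^ 2 = -1 := I_sq
    have g1 : cj (I * (pdt u p + pdx u p) + v p + nsq (v p) * u p) = cj 0 := by
      simp only [nsq_eq]
      simp only [cj, map_add, map_sub, map_mul, map_zero, Complex.conj_I, Complex.conj_conj]
      simp only [← cj.eq_1]
      grind
    have g2 : cj (I * (pdt v p - pdx v p) + u p + nsq (u p) * v p) = cj 0 := by
      simp only [nsq_eq]
      simp only [cj, map_add, map_sub, map_mul, map_zero, Complex.conj_I, Complex.conj_conj]
      simp only [← cj.eq_1]
      grind
    exact ⟨cj_inj g1, cj_inj g2⟩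
end
end

section
/- Let u, v : ℝ² → ℂ be twice continuously differentiable functions of (x,t) satisfying the MT system, and let Λ : ℝ² → ℝ be continuously differentiable with ∂_x Λ = −(|u|² + |v|²) and ∂_t Λ = |u|² − |v|². Define q(x,t) := ū(x,t) e^{−(i/2)Λ(x,t)} and p(x,t) := (2i ∂_x u + u|v|² + v)(x,t) e^{(i/2)Λ(x,t)}. Then (q,p) satisfies the system: ∂_t q − ∂_x q + i p̄ + i q|q|² = 0 and ∂_t p + ∂_x p − i q̄ − i (q̄)²(p̄ + 2i ∂_x q + q|q|²) = 0 at every point of ℝ². -/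
open Complex Matrix

noncomputable section

theorem line_hd {f : ℝ × ℝ → ℂ} {p : ℝ × ℝ} (hf : DifferentiableAt ℝ f p) (d : ℝ × ℝ) :
    HasDerivAt (fun s : ℝ => f (p + s • d)) (fderiv ℝ f p d) 0 := by
  have h := hf.hasFDerivAt.hasLineDerivAt d
  exact h

theorem line_hdr {f : ℝ × ℝ → ℝ} {p : ℝ × ℝ} (hf : DifferentiableAt ℝ f p) (d : ℝ × ℝ) :
    HasDerivAt (fun s : ℝ => f (p + s • d)) (fderiv ℝ f p d) 0 := by
  have h := hf.hasFDerivAt.hasLineDerivAt d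
  exact h

theorem hd_cj {g : ℝ → ℂ} {g' : ℂ} {s : ℝ} (h : HasDerivAt g g' s) :
    HasDerivAt (fun s => cj (g s)) (cj g') s := by
  have := Complex.conjCLE.hasFDerivAt.comp_hasDerivAt s h
  exact this

theorem hd_nsq {g : ℝ → ℂ} {g' : ℂ} {s : ℝ} (h : HasDerivAt g g' s) :
    HasDerivAt (fun s => nsq (g s)) (g' * cj (g s) + g s * cj g') s := by
  simp only [nsq_eq]
  exact h.mul (hd_cj h)

theorem diff_cj {f : ℝ × ℝ → ℂ} (h : Differentiable ℝ f) :
    Differentiable ℝ (fun p => cj (f p)) :=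
  Complex.conjCLE.differentiable.comp h

theorem diff_nsq {f : ℝ × ℝ → ℂ} (h : Differentiable ℝ f) :
    Differentiable ℝ (fun p => nsq (f p)) := by
  simp only [nsq_eq]
  exact h.mul (diff_cj h)

theorem diff_ofReal {f : ℝ × ℝ → ℝ} (h : Differentiable ℝ f) :
    Differentiable ℝ (fun p => ((f p : ℝ) : ℂ)) :=
  Complex.ofRealCLM.differentiable.comp h

/-- derivative of `f * exp (c Λ)`. -/
theorem fd_mul_exp {f : ℝ × ℝ → ℂ} {Λ : ℝ × ℝ → ℝ} (hf : Differentiable ℝ f)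
    (hΛ : Differentiable ℝ Λ) (c : ℂ) (p d : ℝ × ℝ) :
    fderiv ℝ (fun p => f p * Complex.exp (c * (Λ p : ℂ))) p d =
      (fderiv ℝ f p d + f p * (c * ((fderiv ℝ Λ p d : ℝ) : ℂ)))
        * Complex.exp (c * (Λ p : ℂ)) := by
  have hd : Differentiable ℝ (fun p => f p * Complex.exp (c * (Λ p : ℂ))) :=
    hf.mul (((diff_ofReal hΛ).const_mul c).cexp)
  have h1 := line_hd (hd p) d
  have h2 := (line_hd (hf p) d).mul (((line_hdr (hΛ p) d).ofReal_comp.const_mul c).cexp)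
  have := h1.unique h2
  rw [this]
  simp
  ring

theorem fd_cj {f : ℝ × ℝ → ℂ} (hf : Differentiable ℝ f) (p d : ℝ × ℝ) :
    fderiv ℝ (fun p => cj (f p)) p d = cj (fderiv ℝ f p d) :=
  (line_hd (diff_cj hf p) d).unique (hd_cj (line_hd (hf p) d))

theorem fd_P {a u v : ℝ × ℝ → ℂ} (ha : Differentiable ℝ a) (hu : Differentiable ℝ u)
    (hv : Differentiable ℝ v) (c : ℂ) (p d : ℝ × ℝ) :
    fderiv ℝ (fun p => c * a p + u p * nsq (v p) + v p) p d =
      c * fderiv ℝ a p d + (fderiv ℝ u p d * nsq (v p)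
        + u p * (fderiv ℝ v p d * cj (v p) + v p * cj (fderiv ℝ v p d))) + fderiv ℝ v p d := by
  have hd : Differentiable ℝ (fun p => c * a p + u p * nsq (v p) + v p) :=
    ((ha.const_mul c).add (hu.mul (diff_nsq hv))).add hv
  have h2 := (((line_hd (ha p) d).const_mul c).add
    ((line_hd (hu p) d).mul (hd_nsq (line_hd (hv p) d)))).add (line_hd (hv p) d)
  have := (line_hd (hd p) d).unique h2
  rw [this]
  simp

theorem diff_pd {u : ℝ × ℝ → ℂ} (hu : ContDiff ℝ 2 u) (d : ℝ × ℝ) :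
    Differentiable ℝ (fun p => fderiv ℝ u p d) := by
  have h : ContDiff ℝ 1 (fderiv ℝ u) := hu.fderiv_right (by norm_num)
  exact (h.differentiable (by norm_num)).clm_apply (differentiable_const d)

theorem mixed {u : ℝ × ℝ → ℂ} (hu : ContDiff ℝ 2 u) (p d e : ℝ × ℝ) :
    fderiv ℝ (fun p => fderiv ℝ u p d) p e = fderiv ℝ (fun p => fderiv ℝ u p e) p d := by
  have h : ContDiff ℝ 1 (fderiv ℝ u) := hu.fderiv_right (by norm_num)
  have hd := h.differentiable (by norm_num)
  have key : ∀ d e, fderiv ℝ (fun p => fderiv ℝ u p d) p e = fderiv ℝ (fderiv ℝ u) p e d := by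
    intro d e
    rw [fderiv_clm_apply (hd p) (differentiableAt_const d)]
    simp
  rw [key, key]
  exact (hu.contDiffAt.isSymmSndFDerivAt (by simp)) e d

/-- if `(u,v)` solves the MT system and `Λ` is a potential with
`∂ₓΛ = −(|u|²+|v|²)`, `∂ₜΛ = |u|²−|v|²`, then
`q = ū e^{−iΛ/2}`, `p = (2iuₓ + u|v|² + v) e^{iΛ/2}` satisfy the system
`qₜ − qₓ + i p̄ + i q|q|² = 0`,
`pₜ + pₓ − i q̄ − i q̄²(p̄ + 2iqₓ + q|q|²) = 0`. -/
theorem mt_dressing_system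
    (u v : ℝ × ℝ → ℂ) (hu : ContDiff ℝ 2 u) (hv : ContDiff ℝ 2 v)
    (hMT : MTsys u v)
    (Λ : ℝ × ℝ → ℝ) (hΛ : ContDiff ℝ 1 Λ)
    (hΛx : ∀ p : ℝ × ℝ,
      fderiv ℝ Λ p (1, 0) = -(Complex.normSq (u p) + Complex.normSq (v p)))
    (hΛt : ∀ p : ℝ × ℝ,
      fderiv ℝ Λ p (0, 1) = Complex.normSq (u p) - Complex.normSq (v p))
    (q pf : ℝ × ℝ → ℂ)
    (hq : ∀ pt : ℝ × ℝ, q pt = cj (u pt) * Complex.exp (-(Complex.I / 2) * (Λ pt : ℂ)))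
    (hpf : ∀ pt : ℝ × ℝ, pf pt
      = (2 * Complex.I * pdx u pt + u pt * nsq (v pt) + v pt)
        * Complex.exp ((Complex.I / 2) * (Λ pt : ℂ))) :
    ∀ pt : ℝ × ℝ,
      pdt q pt - pdx q pt + Complex.I * cj (pf pt) + Complex.I * q pt * nsq (q pt) = 0 ∧
      pdt pf pt + pdx pf pt - Complex.I * cj (q pt)
        - Complex.I * (cj (q pt)) ^ 2
          * (cj (pf pt) + 2 * Complex.I * pdx q pt + q pt * nsq (q pt)) = 0 := by
  have du : Differentiable ℝ u := hu.differentiable (by norm_num)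
  have dv : Differentiable ℝ v := hv.differentiable (by norm_num)
  have dΛ : Differentiable ℝ Λ := hΛ.differentiable (by norm_num)
  have dux : Differentiable ℝ (pdx u) := diff_pd hu (1, 0)
  have dut : Differentiable ℝ (pdt u) := diff_pd hu (0, 1)
  have dP : Differentiable ℝ (fun p => 2 * Complex.I * pdx u p + u p * nsq (v p) + v p) :=
    ((dux.const_mul _).add (du.mul (diff_nsq dv))).add dv
  obtain rfl : q = _ := funext hq
  obtain rfl : pf = _ := funext hpf
  intro pt
  have hI : Complex.I ^ 2 = -1 := Complex.I_sq
  have e1 := (hMT pt).1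
  have e2 := (hMT pt).2
  -- derivative in x of the first equation
  have hmix : fderiv ℝ (pdx u) pt (0, 1) = fderiv ℝ (pdt u) pt (1, 0) := mixed hu pt (1, 0) (0, 1)
  have e3 : fderiv ℝ (pdt u) pt (1, 0) = -1 * fderiv ℝ (pdx u) pt (1, 0) + Complex.I *
      (pdx u pt * nsq (v pt) + u pt * (pdx v pt * cj (v pt) + v pt * cj (pdx v pt)) + pdx v pt) := by
    have hf : pdt u = fun p => -1 * pdx u p + Complex.I * (0 * u p + u p * nsq (v p) + v p) := by
      funext p
      linear_combination (-Complex.I) * (hMT p).1 + (pdt u p + pdx u p) * Complex.I_sq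
    have h2 := ((line_hd (dux pt) (1, 0)).const_mul (-1)).add
      (((((line_hd (du pt) (1, 0)).const_mul 0).add ((line_hd (du pt) (1, 0)).mul
        (hd_nsq (line_hd (dv pt) (1, 0))))).add (line_hd (dv pt) (1, 0))).const_mul Complex.I)
    have h1 := line_hd (dut pt) (1, 0)
    refine (h1.unique (h2.congr_of_eventuallyEq (Filter.Eventually.of_forall
      fun s => congrFun hf (pt + s • (1, 0))))).trans ?_
    simp [pdx]
  have lx : ((fderiv ℝ Λ pt (1, 0) : ℝ) : ℂ) = -(u pt * cj (u pt) + v pt * cj (v pt)) := by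
    rw [hΛx, ← nsq_eq, ← nsq_eq]; simp [nsq]
  have lt : ((fderiv ℝ Λ pt (0, 1) : ℝ) : ℂ) = u pt * cj (u pt) - v pt * cj (v pt) := by
    rw [hΛt, ← nsq_eq, ← nsq_eq]; simp [nsq]
  have f1 : cj (Complex.exp ((Complex.I / 2) * (Λ pt : ℂ)))
      = Complex.exp (-(Complex.I / 2) * (Λ pt : ℂ)) := by
    unfold cj; rw [← Complex.exp_conj]; simp [Complex.conj_ofNat]
    try ring_nf
  have f2 : cj (Complex.exp (-(Complex.I / 2) * (Λ pt : ℂ)))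
      = Complex.exp ((Complex.I / 2) * (Λ pt : ℂ)) := by
    unfold cj; rw [← Complex.exp_conj]; simp [Complex.conj_ofNat]
    try ring_nf
  have f3 : Complex.exp ((Complex.I / 2) * (Λ pt : ℂ))
      * Complex.exp (-(Complex.I / 2) * (Λ pt : ℂ)) = 1 := by
    rw [← Complex.exp_add]; simp
  have cm : ∀ a b, cj (a * b) = cj a * cj b := fun a b => map_mul _ a b
  have ca : ∀ a b, cj (a + b) = cj a + cj b := fun a b => map_add _ a b
  have cc : ∀ a, cj (cj a) = a := fun a => Complex.conj_conj a
  have cI : cj Complex.I = -Complex.I := Complex.conj_I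
  have c2 : cj 2 = 2 := Complex.conj_ofNat 2
  have ut : pdt u pt = -pdx u pt + Complex.I * (v pt + v pt * cj (v pt) * u pt) := by
    rw [nsq_eq] at e1
    linear_combination (-Complex.I) * e1 + (pdt u pt + pdx u pt) * hI
  have vt : pdt v pt = pdx v pt + Complex.I * (u pt + u pt * cj (u pt) * v pt) := by
    rw [nsq_eq] at e2
    linear_combination (-Complex.I) * e2 + (pdt v pt - pdx v pt) * hI
  have utc := congrArg cj ut
  have vtc := congrArg cj vt
  have cn : ∀ a, cj (-a) = -cj a := fun a => map_neg _ a
  simp only [cm, ca, cc, cI, cn] at utc vtc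
  have q_x : pdx (fun pt => cj (u pt) * Complex.exp (-(Complex.I / 2) * (Λ pt : ℂ))) pt = _ :=
    fd_mul_exp (diff_cj du) dΛ (-(Complex.I / 2)) pt (1, 0)
  have q_t : pdt (fun pt => cj (u pt) * Complex.exp (-(Complex.I / 2) * (Λ pt : ℂ))) pt = _ :=
    fd_mul_exp (diff_cj du) dΛ (-(Complex.I / 2)) pt (0, 1)
  have p_x : pdx (fun pt => (2 * Complex.I * pdx u pt + u pt * nsq (v pt) + v pt)
        * Complex.exp ((Complex.I / 2) * (Λ pt : ℂ))) pt = _ :=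
    fd_mul_exp dP dΛ (Complex.I / 2) pt (1, 0)
  have p_t : pdt (fun pt => (2 * Complex.I * pdx u pt + u pt * nsq (v pt) + v pt)
        * Complex.exp ((Complex.I / 2) * (Λ pt : ℂ))) pt = _ :=
    fd_mul_exp dP dΛ (Complex.I / 2) pt (0, 1)
  rw [fd_cj du, lx] at q_x
  rw [fd_cj du, lt] at q_t
  rw [fd_P dux du dv, lx] at p_x
  rw [fd_P dux du dv, lt, hmix, e3] at p_t
  change _ = (cj (pdx u pt) + _) * _ at q_x
  change _ = (cj (pdt u pt) + _) * _ at q_t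
  have hux : fderiv ℝ u pt (1, 0) = pdx u pt := rfl
  have hvx : fderiv ℝ v pt (1, 0) = pdx v pt := rfl
  have hut : fderiv ℝ u pt (0, 1) = pdt u pt := rfl
  have hvt : fderiv ℝ v pt (0, 1) = pdt v pt := rfl
  rw [hux, hvx] at p_x
  rw [hut, hvt, vtc, ut, vt] at p_t
  rw [utc] at q_t
  rw [q_x, q_t, p_x, p_t]
  simp only [cm, ca, cc, cI, c2, nsq_eq, f1, f2]
  clear q_x q_t p_x p_t
  generalize Complex.exp ((Complex.I / 2) * (Λ pt : ℂ)) = E at *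
  generalize Complex.exp (-(Complex.I / 2) * (Λ pt : ℂ)) = F at *
  generalize fderiv ℝ (pdx u) pt (1, 0) = uxx at *
  generalize cj (pdx u pt) = cux at *
  generalize cj (pdx v pt) = cvx at *
  generalize cj (u pt) = U at *
  generalize cj (v pt) = V at *
  generalize pdx u pt = ux at *
  generalize pdx v pt = vx at *
  generalize u pt = u at *
  generalize v pt = v at *
  clear * - hI f3
  constructor
  · linear_combination (-2 * cux * F) * hI + (Complex.I * U ^ 2 * F * u) * f3
  · linear_combination (E * (2 * u * v * cvx + 2 * u * vx * V + 2 * vx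
      - Complex.I * u ^ 2 * U * (u * U + v * V))) * hI + (-Complex.I * u ^ 2 * E * ((U * v * V + V
      + Complex.I ^ 2 * U * (u * U + v * V)) + (E * F + 1) * U ^ 2 * u)) * f3
end
end
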